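/- arXiv:math/9402202 — 8 statements merged into one kernel-verified Lean document; each statement's English description precedes it below -/
import Mathlib

section
/- Let n ≥ 1, let f : ℂⁿ → ℂ be entire and not identically zero, let ω_p, ω_q ∈ ℂⁿ, and let g_p, g_q : ℂⁿ → ℂ be entire functions satisfying f(z+ω_p) = e^{g_p(z)} f(z) and f(z+ω_q) = e^{g_q(z)} f(z) for all z ∈ ℂⁿ. Then there exists an integer N such that for every z ∈ ℂⁿ one has g_q(z+ω_p) − g_q(z) − g_p(z+ω_q) + g_p(z) = 2πi N. (In particular this quantity is constant in z and lies in 2πi ℤ.) -/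
open Complex

/-- If a product of two entire functions on a complex normed space vanishes identically, one of
the factors does. -/
theorem eq_zero_of_differentiable_mul_eq_zero {E : Type*} [NormedAddCommGroup E]
    [NormedSpace ℂ E] {u f : E → ℂ} (hu : Differentiable ℂ u) (hf : Differentiable ℂ f)
    (h : ∀ z, u z * f z = 0) (hf0 : f ≠ 0) : u = 0 := by
  obtain ⟨a, ha⟩ := Function.ne_iff.mp hf0
  funext z
  let ℓ : ℂ → E := fun t => a + t • (z - a)
  have hℓ : Differentiable ℂ ℓ := by fun_prop
  have hua : AnalyticOnNhd ℂ (u ∘ ℓ) Set.univ :=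
    (hu.comp hℓ).differentiableOn.analyticOnNhd isOpen_univ
  have hev : ∀ᶠ t in nhds (0 : ℂ), (u ∘ ℓ) t = 0 := by
    have hne : (f ∘ ℓ) 0 ≠ 0 := by simpa [ℓ] using ha
    filter_upwards [(hf.comp hℓ).continuous.continuousAt.eventually_ne hne] with t ht
    exact (mul_eq_zero.mp (h (ℓ t))).resolve_right ht
  have := hua.eqOn_zero_of_preconnected_of_eventuallyEq_zero isPreconnected_univ
    (Set.mem_univ 0) hev (Set.mem_univ 1)
  simpa [ℓ] using this

/-- An entire function all of whose values are logarithms of `1` is constant. -/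
theorem exists_int_eq_of_exp_eq_one {E : Type*} [NormedAddCommGroup E]
    [NormedSpace ℂ E] {h : E → ℂ} (hh : Differentiable ℂ h) (hexp : ∀ z, exp (h z) = 1) :
    ∃ N : ℤ, ∀ z, h z = N * (2 * Real.pi * I) := by
  obtain ⟨N, hN⟩ := Complex.exp_eq_one_iff.mp (hexp 0)
  have hd : ∀ z, fderiv ℂ h z = 0 := fun z => by
    have h1 := (hh z).hasFDerivAt.cexp
    rw [funext hexp, hexp, one_smul] at h1
    exact h1.unique (hasFDerivAt_const 1 z)
  exact ⟨N, fun z => (is_const_of_fderiv_eq_zero hh hd z 0).trans hN⟩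

/-- The quantity `Δ_p g_q - Δ_q g_p` built from the multipliers of an entire
function `f` with `f(z+ω_j) = e^{g_j(z)} f(z)` is a constant of the form `2πiN`, `N ∈ ℤ`. -/
theorem index_exists (n : ℕ) (hn : 1 ≤ n)
    (f : (Fin n → ℂ) → ℂ) (hf : Differentiable ℂ f) (hf0 : f ≠ 0)
    (ωp ωq : Fin n → ℂ) (gp gq : (Fin n → ℂ) → ℂ)
    (hgp : Differentiable ℂ gp) (hgq : Differentiable ℂ gq)
    (hfp : ∀ z, f (z + ωp) = Complex.exp (gp z) * f z)
    (hfq : ∀ z, f (z + ωq) = Complex.exp (gq z) * f z) :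
    ∃ N : ℤ, ∀ z, gq (z + ωp) - gq z - gp (z + ωq) + gp z
      = 2 * (Real.pi : ℂ) * Complex.I * (N : ℂ) := by
  set h : (Fin n → ℂ) → ℂ := fun z => gq (z + ωp) - gq z - gp (z + ωq) + gp z with hdef
  have hh : Differentiable ℂ h := by fun_prop
  have hmul : ∀ z, (exp (h z) - 1) * f z = 0 := fun z => by
    have hpq : exp (gq (z + ωp)) * (exp (gp z) * f z)
        = exp (gp (z + ωq)) * (exp (gq z) * f z) := by
      rw [← hfp, ← hfq, ← hfq, ← hfp, add_right_comm]
    have hz : exp (h z) * (exp (gp (z + ωq)) * exp (gq z))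
        = exp (gq (z + ωp)) * exp (gp z) := by
      simp only [← exp_add, hdef]
      ring_nf
    have hne : exp (gp (z + ωq)) * exp (gq z) ≠ 0 := mul_ne_zero (exp_ne_zero _) (exp_ne_zero _)
    refine mul_left_cancel₀ hne ?_
    linear_combination f z * hz + hpq
  have hexp := eq_zero_of_differentiable_mul_eq_zero (hh.cexp.sub_const 1) hf hmul hf0
  obtain ⟨N, hN⟩ := exists_int_eq_of_exp_eq_one hh fun z => sub_eq_zero.mp (congrFun hexp z)
  exact ⟨N, fun z => (hN z).trans (mul_comm _ _)⟩
end

section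
/- Let n ≥ 1, let f : ℂⁿ → ℂ be entire and not identically zero, let ω_p, ω_q ∈ ℂⁿ, let g_p, g_q be entire with f(z+ω_j) = e^{g_j(z)} f(z) for all z (j = p, q), and let N ∈ ℤ be the index, i.e. g_q(z+ω_p) − g_q(z) − g_p(z+ω_q) + g_p(z) = 2πi N for all z. Let h : ℂⁿ → ℂ be entire, set f̃ = f·e^{h}, and let g̃_p, g̃_q be entire with f̃(z+ω_j) = e^{g̃_j(z)} f̃(z) for all z (j = p, q), with index Ñ ∈ ℤ, i.e. g̃_q(z+ω_p) − g̃_q(z) − g̃_p(z+ω_q) + g̃_p(z) = 2πi Ñ for all z. Then Ñ = N. (The index of a periodic divisor does not depend on the choice of the defining entire function.) -/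
open Complex

/-- If `exp ∘ d` is trivial off the zero set of a nonzero continuous function, then the entire
function `d` is constant. -/
theorem exists_eq_const_of_exp_mul_eq {E : Type*} [NormedAddCommGroup E] [NormedSpace ℂ E]
    {f d : E → ℂ} (hf : Continuous f) (hf0 : f ≠ 0) (hd : Differentiable ℂ d)
    (hfd : ∀ z, f z = Complex.exp (d z) * f z) : ∃ c, ∀ z, d z = c := by
  obtain ⟨z₀, hz₀⟩ := Function.ne_iff.mp hf0
  refine ⟨d z₀, fun z => ?_⟩
  have exp_eq_one : ∀ w, f w ≠ 0 → Complex.exp (d w) = 1 := fun w hw =>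
    mul_right_cancel₀ hw ((hfd w).symm.trans (one_mul _).symm)
  have locally_const : ∀ᶠ w in nhds z₀, d w = d z₀ := by
    filter_upwards [hf.continuousAt.eventually_ne hz₀,
      Metric.continuousAt_iff'.mp hd.continuous.continuousAt Real.pi Real.pi_pos] with w hw hdist
    rw [dist_eq_norm] at hdist
    have him := abs_lt.mp ((Complex.abs_im_le_norm (d w - d z₀)).trans_lt hdist)
    have hlog := Complex.log_exp him.1 him.2.le
    rw [Complex.exp_sub, exp_eq_one w hw, exp_eq_one z₀ hz₀, div_one, Complex.log_one] at hlog
    exact sub_eq_zero.mp hlog.symm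
  have line_diff : Differentiable ℂ fun t : ℂ => z₀ + t • (z - z₀) := by fun_prop
  have line_tendsto : Filter.Tendsto (fun t : ℂ => z₀ + t • (z - z₀)) (nhds 0) (nhds z₀) := by
    simpa using line_diff.continuous.tendsto 0
  have line_eq := AnalyticOnNhd.eq_of_eventuallyEq (z₀ := (0 : ℂ))
    (fun t _ => (hd.comp line_diff).analyticAt t)
    (fun t _ => analyticAt_const (v := d z₀)) (line_tendsto.eventually locally_const)
  simpa using congrFun line_eq 1

/-- When `f` is multiplied by `exp ∘ h`, a multiplier exponent of `f` changes by the increment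
of `h` up to an additive constant. -/
theorem exists_multiplier_sub_eq_const {E : Type*} [NormedAddCommGroup E] [NormedSpace ℂ E]
    {f g h k : E → ℂ} {ω : E} (hf : Continuous f) (hf0 : f ≠ 0)
    (hg : Differentiable ℂ g) (hh : Differentiable ℂ h) (hk : Differentiable ℂ k)
    (hfg : ∀ z, f (z + ω) = Complex.exp (g z) * f z)
    (hfk : ∀ z, f (z + ω) * Complex.exp (h (z + ω))
      = Complex.exp (k z) * (f z * Complex.exp (h z))) :
    ∃ c, ∀ z, k z - g z - (h (z + ω) - h z) = c := by
  refine exists_eq_const_of_exp_mul_eq hf hf0 (by fun_prop) fun z => ?_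
  have e := hfk z
  rw [hfg] at e
  simp only [Complex.exp_sub]
  field_simp [Complex.exp_ne_zero]
  linear_combination e

/-- The index `N(ω_p, ω_q)` does not depend on the choice of the entire function
defining the divisor: replacing `f` by `f·e^h` gives the same index. -/
theorem index_independent_of_function (n : ℕ) (hn : 1 ≤ n)
    (f : (Fin n → ℂ) → ℂ) (hf : Differentiable ℂ f) (hf0 : f ≠ 0)
    (ωp ωq : Fin n → ℂ) (gp gq : (Fin n → ℂ) → ℂ)
    (hgp : Differentiable ℂ gp) (hgq : Differentiable ℂ gq)
    (hfp : ∀ z, f (z + ωp) = Complex.exp (gp z) * f z)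
    (hfq : ∀ z, f (z + ωq) = Complex.exp (gq z) * f z)
    (N : ℤ)
    (hN : ∀ z, gq (z + ωp) - gq z - gp (z + ωq) + gp z
      = 2 * (Real.pi : ℂ) * Complex.I * (N : ℂ))
    (h : (Fin n → ℂ) → ℂ) (hh : Differentiable ℂ h)
    (ftil : (Fin n → ℂ) → ℂ) (hftil : ∀ z, ftil z = f z * Complex.exp (h z))
    (gptil gqtil : (Fin n → ℂ) → ℂ)
    (hgptil : Differentiable ℂ gptil) (hgqtil : Differentiable ℂ gqtil)
    (hfptil : ∀ z, ftil (z + ωp) = Complex.exp (gptil z) * ftil z)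
    (hfqtil : ∀ z, ftil (z + ωq) = Complex.exp (gqtil z) * ftil z)
    (Ntil : ℤ)
    (hNtil : ∀ z, gqtil (z + ωp) - gqtil z - gptil (z + ωq) + gptil z
      = 2 * (Real.pi : ℂ) * Complex.I * (Ntil : ℂ)) :
    Ntil = N := by
  simp only [hftil] at hfptil hfqtil
  obtain ⟨cp, hcp⟩ := exists_multiplier_sub_eq_const hf.continuous hf0 hgp hh hgptil hfp hfptil
  obtain ⟨cq, hcq⟩ := exists_multiplier_sub_eq_const hf.continuous hf0 hgq hh hgqtil hfq hfqtil
  have swap : (0 : Fin n → ℂ) + ωp + ωq = 0 + ωq + ωp := add_right_comm _ _ _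
  have hcqp := hcq (0 + ωp)
  rw [swap] at hcqp
  have key : 2 * (Real.pi : ℂ) * Complex.I * (Ntil : ℂ)
      = 2 * (Real.pi : ℂ) * Complex.I * (N : ℂ) := by
    linear_combination hN 0 - hNtil 0 + hcqp - hcq 0 - hcp (0 + ωq) + hcp 0
  exact_mod_cast mul_left_cancel₀ Complex.two_pi_I_ne_zero key
end

section
/- Let n ≥ 1 and let p, q ∈ Fin n with p ≠ q. Let e_p, e_q denote the standard basis vectors of ℂⁿ and let β_p : ℂⁿ → ℂⁿ be the map negating the p-th coordinate and fixing all others. Let f : ℂⁿ → ℂ be entire and not identically zero, let g_p, g_q be entire with f(z+e_p) = e^{g_p(z)} f(z) and f(z+e_q) = e^{g_q(z)} f(z) for all z, and let N ∈ ℤ satisfy g_q(z+e_p) − g_q(z) − g_p(z+e_q) + g_p(z) = 2πi N for all z. Define f*(z) = f(β_p z), g*_p(z) = −g_p(β_p z − e_p), and g*_q(z) = g_q(β_p z). Then: (i) f*(z+e_p) = e^{g*_p(z)} f*(z) and f*(z+e_q) = e^{g*_q(z)} f*(z) for all z; and (ii) g*_q(z+e_p) − g*_q(z) − g*_p(z+e_q)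 + g*_p(z) = −2πi N for all z. (Reflecting a periodic divisor in the p-th coordinate reverses the sign of its index N(e_p, e_q).) -/
open Complex

/-- The reflection of `ℂⁿ` negating the `p`-th coordinate. -/
def betaMap (n : ℕ) (p : Fin n) (z : Fin n → ℂ) : Fin n → ℂ :=
  fun i => if i = p then -z i else z i

theorem betaMap_add_single_self {n : ℕ} (p : Fin n) (z : Fin n → ℂ) (c : ℂ) :
    betaMap n p (z + Pi.single p c) = betaMap n p z - Pi.single p c := by
  ext i
  by_cases h : i = p
  · subst h
    simp [betaMap, sub_eq_add_neg, add_comm]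
  · simp [betaMap, h]

theorem betaMap_add_single_of_ne {n : ℕ} {p q : Fin n} (hpq : p ≠ q) (z : Fin n → ℂ) (c : ℂ) :
    betaMap n p (z + Pi.single q c) = betaMap n p z + Pi.single q c := by
  ext i
  by_cases h : i = p
  · subst h
    simp [betaMap, hpq]
  · simp [betaMap, h]

/-- Property 2 of the index: reflecting in the `p`-th coordinate reverses the sign of
the index `N(e_p, e_q)`.  Here `f*(z) = f(β_p z)`, `g*_p(z) = -g_p(β_p z - e_p)`,
`g*_q(z) = g_q(β_p z)`. -/
theorem index_reflection (n : ℕ) (hn : 1 ≤ n) (p q : Fin n) (hpq : p ≠ q)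
    (f : (Fin n → ℂ) → ℂ) (hf : Differentiable ℂ f) (hf0 : f ≠ 0)
    (gp gq : (Fin n → ℂ) → ℂ)
    (hgp : Differentiable ℂ gp) (hgq : Differentiable ℂ gq)
    (hfp : ∀ z, f (z + Pi.single p 1) = Complex.exp (gp z) * f z)
    (hfq : ∀ z, f (z + Pi.single q 1) = Complex.exp (gq z) * f z)
    (N : ℤ)
    (hN : ∀ z, gq (z + Pi.single p 1) - gq z - gp (z + Pi.single q 1) + gp z
      = 2 * (Real.pi : ℂ) * Complex.I * (N : ℂ)) :
    (∀ z, f (betaMap n p (z + Pi.single p 1))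
        = Complex.exp (-gp (betaMap n p z - Pi.single p 1)) * f (betaMap n p z)) ∧
    (∀ z, f (betaMap n p (z + Pi.single q 1))
        = Complex.exp (gq (betaMap n p z)) * f (betaMap n p z)) ∧
    (∀ z, gq (betaMap n p (z + Pi.single p 1)) - gq (betaMap n p z)
        - (-gp (betaMap n p (z + Pi.single q 1) - Pi.single p 1))
        + (-gp (betaMap n p z - Pi.single p 1))
      = -(2 * (Real.pi : ℂ) * Complex.I * (N : ℂ))) := by
  refine ⟨fun z => ?_, fun z => ?_, fun z => ?_⟩
  · have h := hfp (betaMap n p z - Pi.single p 1)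
    rw [sub_add_cancel] at h
    rw [betaMap_add_single_self, h, ← mul_assoc, ← Complex.exp_add, neg_add_cancel,
      Complex.exp_zero, one_mul]
  · rw [betaMap_add_single_of_ne hpq, hfq]
  · have h := hN (betaMap n p z - Pi.single p 1)
    rw [sub_add_cancel] at h
    rw [betaMap_add_single_self, betaMap_add_single_of_ne hpq, add_sub_right_comm]
    linear_combination -h
end

section
/- Let n ≥ 1, let k ∈ ℤⁿ be a nonzero integer vector whose coordinates have greatest common divisor 1, and let c ∈ ℂ. Define f : ℂⁿ → ℂ by f(z) = sin(π(⟨k,z⟩+c))·e^{iπ(⟨k,z⟩+c)}, where ⟨k,z⟩ = Σ_j k_j z_j. Then: (i) f is entire; (ii) f(z + e_j) = f(z) for every standard basis vector e_j of ℂⁿ and every z (f is periodic with periods e_1, …, e_n); and (iii) f(z) = 0 if and only if there exists κ ∈ ℤⁿ such that ⟨k, z−κ⟩ + c = 0, i.e. the zero set of f is the periodic reproduction Ŝ_L = ⋃_{κ∈ℤⁿ} {z : ⟨k,z−κ⟩+c = 0} of the hyperplane L = {z : ⟨k,z⟩+c = 0}. -/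
open Complex

theorem Finset.exists_gcd_eq_sum_mul {ι : Type*} (s : Finset ι) (k : ι → ℤ) :
    ∃ x : ι → ℤ, s.gcd k = ∑ i ∈ s, k i * x i := by
  classical
  induction s using Finset.induction_on with
  | empty => exact ⟨0, by simp⟩
  | insert a s ha ih =>
    obtain ⟨x, hx⟩ := ih
    obtain ⟨u, v, huv⟩ := exists_gcd_eq_mul_add_mul (k a) (s.gcd k)
    refine ⟨Function.update (fun i => x i * v) a u, ?_⟩
    rw [Finset.gcd_insert, Finset.sum_insert ha, Function.update_self, huv, hx, Finset.sum_mul]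
    congr 1
    refine Finset.sum_congr rfl fun i hi => ?_
    rw [Function.update_of_ne (ne_of_mem_of_not_mem hi ha), mul_assoc]

theorem Complex.sin_pi_mul_exp_add_int (w : ℂ) (m : ℤ) :
    sin (Real.pi * (w + m)) * exp (I * Real.pi * (w + m)) =
      sin (Real.pi * w) * exp (I * Real.pi * w) := by
  have key (u : ℂ) : sin (Real.pi * u) * exp (I * Real.pi * u) =
      (1 - exp (2 * Real.pi * I * u)) * I / 2 := by
    have h₀ : exp (-(Real.pi * u) * I) * exp (I * Real.pi * u) = 1 := by
      rw [← exp_add, ← exp_zero]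
      ring_nf
    have h₁ : exp (Real.pi * u * I) * exp (I * Real.pi * u) = exp (2 * Real.pi * I * u) := by
      rw [← exp_add]
      ring_nf
    rw [sin, ← h₁, ← h₀]
    ring
  have h : exp (2 * Real.pi * I * (w + m)) = exp (2 * Real.pi * I * w) := by
    rw [mul_add, exp_add, mul_comm _ (m : ℂ), exp_int_mul_two_pi_mul_I, mul_one]
  rw [key, key, h]

/-- For `l ∈ 𝓛₁`, i.e. `l(z) = ⟨k,z⟩ + c` with `k ∈ ℤⁿ` primitive, the function
`f(z) = sin(π l(z)) e^{iπ l(z)}` is entire, `ℤⁿ`-periodic, and its zero set is the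
periodic reproduction `Ŝ_L` of the hyperplane `L = {l = 0}`. -/
theorem periodic_function_for_L1 (n : ℕ) (hn : 1 ≤ n)
    (k : Fin n → ℤ) (hk : k ≠ 0) (hgcd : Finset.univ.gcd k = 1) (c : ℂ)
    (f : (Fin n → ℂ) → ℂ)
    (hf : ∀ z, f z = Complex.sin ((Real.pi : ℂ) * ((∑ j, (k j : ℂ) * z j) + c)) *
        Complex.exp (Complex.I * (Real.pi : ℂ) * ((∑ j, (k j : ℂ) * z j) + c))) :
    Differentiable ℂ f ∧
    (∀ j : Fin n, ∀ z, f (z + Pi.single j 1) = f z) ∧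
    (∀ z, f z = 0 ↔ ∃ κ : Fin n → ℤ, (∑ j, (k j : ℂ) * (z j - (κ j : ℂ))) + c = 0) := by
  refine ⟨?_, fun j z => ?_, fun z => ?_⟩
  · rw [funext hf]
    fun_prop
  · have h : (∑ i, (k i : ℂ) * (z + Pi.single j 1 : Fin n → ℂ) i) + c =
        (∑ i, (k i : ℂ) * z i) + c + (k j : ℂ) := by
      simp [mul_add, Finset.sum_add_distrib, Pi.single_apply]
      ring
    rw [hf, hf, h, sin_pi_mul_exp_add_int]
  · have h (κ : Fin n → ℤ) : (∑ j, (k j : ℂ) * (z j - (κ j : ℂ))) + c =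
        (∑ j, (k j : ℂ) * z j) + c - ((∑ j, k j * κ j : ℤ) : ℂ) := by
      push_cast
      simp only [mul_sub, Finset.sum_sub_distrib]
      ring
    have hpi : (Real.pi : ℂ) ≠ 0 := ofReal_ne_zero.mpr Real.pi_ne_zero
    simp only [hf, mul_eq_zero, exp_ne_zero, or_false, sin_eq_zero_iff, h, sub_eq_zero]
    constructor
    · rintro ⟨m, hm⟩
      obtain ⟨x, hx⟩ := Finset.univ.exists_gcd_eq_sum_mul k
      refine ⟨fun j => x j * m, ?_⟩
      have hsum : ∑ j, k j * (x j * m) = m := by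
        simp only [← mul_assoc]
        rw [← Finset.sum_mul, ← hx, hgcd, one_mul]
      rw [hsum]
      exact mul_left_cancel₀ hpi (hm.trans (mul_comm _ _))
    · rintro ⟨κ, hκ⟩
      exact ⟨∑ j, k j * κ j, by rw [hκ, mul_comm]⟩
end

section
/- Let b₁, b₂, c ∈ ℂ with (b₁, b₂) ≠ (0,0), and let Z = {ζ ∈ ℂ² : b₁ζ₁ + b₂ζ₂ + c = 0}. Then the following are equivalent: (i) the distance from a real point ξ ∈ ℝ² (viewed inside ℂ²) to the set Z tends to infinity as |ξ| → ∞, i.e. for every M > 0 there exists R > 0 such that every ξ ∈ ℝ² ⊂ ℂ² with |ξ| ≥ R satisfies infDist(ξ, Z) ≥ M; (ii) b₁ ≠ 0, b₂ ≠ 0, and Im(b₂/b₁) ≠ 0. (This is the criterion for hypoellipticity of the linear function l*(ζ) = b₁ζ₁ + b₂ζ₂ + c.) -/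
open Complex

lemma complex_line_nonempty {b₁ b₂ : ℂ} (c : ℂ) (hb : (b₁, b₂) ≠ (0, 0)) :
    {ζ : Fin 2 → ℂ | b₁ * ζ 0 + b₂ * ζ 1 + c = 0}.Nonempty := by
  by_cases h : b₁ = 0
  · have h2 : b₂ ≠ 0 := fun h2 => hb (by rw [h, h2])
    refine ⟨![0, -c / b₂], ?_⟩
    simp
    field_simp
    ring
  · refine ⟨![-c / b₁, 0], ?_⟩
    simp
    field_simp
    ring

/-- A line whose direction contains a nonzero real vector stays at bounded distance from
arbitrarily large real points. -/
lemma exists_infDist_lt_of_real_direction {b₁ b₂ c : ℂ}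
    (hne : {ζ : Fin 2 → ℂ | b₁ * ζ 0 + b₂ * ζ 1 + c = 0}.Nonempty)
    (v : Fin 2 → ℝ) (hv : v ≠ 0) (h : b₁ * v 0 + b₂ * v 1 = 0) :
    ∃ M : ℝ, 0 < M ∧ ∀ R : ℝ, 0 < R → ∃ ξ : Fin 2 → ℝ, R ≤ ‖ξ‖ ∧
      Metric.infDist (fun i => ((ξ i : ℝ) : ℂ))
        {ζ : Fin 2 → ℂ | b₁ * ζ 0 + b₂ * ζ 1 + c = 0} < M := by
  obtain ⟨z, hz⟩ := hne
  refine ⟨‖z‖ + 1, by positivity, fun R hR => ⟨(R / ‖v‖) • v, ?_, ?_⟩⟩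
  · have : 0 < ‖v‖ := norm_pos_iff.mpr hv
    rw [norm_smul, Real.norm_of_nonneg (by positivity)]
    field_simp
    rfl
  · set ξ : Fin 2 → ℂ := fun i => ((((R / ‖v‖) • v) i : ℝ) : ℂ) with hξ
    have hmem : ξ + z ∈ {ζ : Fin 2 → ℂ | b₁ * ζ 0 + b₂ * ζ 1 + c = 0} := by
      simp only [Set.mem_ofPred_eq, hξ, Pi.add_apply, Pi.smul_apply, smul_eq_mul,
        ofReal_mul] at hz ⊢
      linear_combination hz + ((R / ‖v‖ : ℝ) : ℂ) * h
    have hd := Metric.infDist_le_dist_of_mem (x := ξ) hmem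
    rw [dist_self_add_right] at hd
    linarith

lemma norm_le_mul_norm_add_mul (t : ℂ) (ht : t.im ≠ 0) (ξ : Fin 2 → ℝ) :
    ‖ξ‖ ≤ (1 + (‖t‖ + 1) / |t.im|) * ‖(ξ 0 : ℂ) + t * ξ 1‖ := by
  set w := ‖(ξ 0 : ℂ) + t * ξ 1‖ with hw
  have hpos : 0 < |t.im| := abs_pos.mpr ht
  have h1 : |ξ 1| ≤ w / |t.im| := by
    have := abs_im_le_norm ((ξ 0 : ℂ) + t * ξ 1)
    rw [le_div_iff₀ hpos, mul_comm, ← abs_mul]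
    simpa using this
  have h0 : |ξ 0| ≤ w + ‖t‖ * |ξ 1| := by
    have := norm_sub_le ((ξ 0 : ℂ) + t * ξ 1) (t * ξ 1)
    simpa using this
  have hw0 : 0 ≤ w := norm_nonneg _
  have h2 : ‖t‖ * |ξ 1| ≤ ‖t‖ * (w / |t.im|) := by gcongr
  have h3 : 0 ≤ ‖t‖ * (w / |t.im|) := by positivity
  have h4 : 0 ≤ w / |t.im| := by positivity
  have e : (1 + (‖t‖ + 1) / |t.im|) * w = w + ‖t‖ * (w / |t.im|) + w / |t.im| := by ring
  rw [e, pi_norm_le_iff_of_nonneg (by positivity)]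
  intro i
  fin_cases i
  · simp only [Fin.zero_eta, Real.norm_eq_abs]
    linarith
  · simp only [Fin.mk_one, Real.norm_eq_abs]
    linarith

lemma norm_eval_le_mul_infDist {b₁ b₂ c : ℂ}
    (hne : {ζ : Fin 2 → ℂ | b₁ * ζ 0 + b₂ * ζ 1 + c = 0}.Nonempty)
    (hS : 0 < ‖b₁‖ + ‖b₂‖) (x : Fin 2 → ℂ) :
    ‖b₁ * x 0 + b₂ * x 1 + c‖ / (‖b₁‖ + ‖b₂‖) ≤
      Metric.infDist x {ζ : Fin 2 → ℂ | b₁ * ζ 0 + b₂ * ζ 1 + c = 0} := by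
  rw [Metric.le_infDist hne]
  intro z hz
  rw [div_le_iff₀ hS, dist_eq_norm]
  have e : b₁ * x 0 + b₂ * x 1 + c = b₁ * (x - z) 0 + b₂ * (x - z) 1 := by
    simp only [Set.mem_ofPred_eq, Pi.sub_apply] at hz ⊢
    linear_combination hz
  calc ‖b₁ * x 0 + b₂ * x 1 + c‖ ≤ ‖b₁‖ * ‖(x - z) 0‖ + ‖b₂‖ * ‖(x - z) 1‖ := by
        rw [e, ← norm_mul, ← norm_mul]
        exact norm_add_le _ _
    _ ≤ ‖b₁‖ * ‖x - z‖ + ‖b₂‖ * ‖x - z‖ := by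
        gcongr <;> exact norm_le_pi_norm _ _
    _ = ‖x - z‖ * (‖b₁‖ + ‖b₂‖) := by ring

/-- Hypoellipticity criterion for the linear function `l*(ζ) = b₁ζ₁ + b₂ζ₂ + c`:
the distance from real points `ξ ∈ ℝ²` to the zero set tends to `∞` as `ξ → ∞`
if and only if `b₁ ≠ 0`, `b₂ ≠ 0` and `Im (b₂/b₁) ≠ 0`. -/
theorem hypoelliptic_criterion (b₁ b₂ c : ℂ) (hb : (b₁, b₂) ≠ (0, 0)) :
    (∀ M : ℝ, 0 < M → ∃ R : ℝ, 0 < R ∧ ∀ ξ : Fin 2 → ℝ, R ≤ ‖ξ‖ →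
      M ≤ Metric.infDist (fun i => ((ξ i : ℝ) : ℂ))
            {ζ : Fin 2 → ℂ | b₁ * ζ 0 + b₂ * ζ 1 + c = 0}) ↔
    (b₁ ≠ 0 ∧ b₂ ≠ 0 ∧ (b₂ / b₁).im ≠ 0) := by
  have hne := complex_line_nonempty c hb
  constructor
  · intro H
    have key : ∀ v : Fin 2 → ℝ, v ≠ 0 → b₁ * v 0 + b₂ * v 1 ≠ 0 := by
      intro v hv h
      obtain ⟨M, hM, hbd⟩ := exists_infDist_lt_of_real_direction hne v hv h
      obtain ⟨R, hR, hfar⟩ := H M hM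
      obtain ⟨ξ, hξ, hlt⟩ := hbd R hR
      exact absurd (hfar ξ hξ) (not_le.mpr hlt)
    have h₁ : b₁ ≠ 0 := by simpa using key ![1, 0] (by simp)
    have h₂ : b₂ ≠ 0 := by simpa using key ![0, 1] (by simp)
    refine ⟨h₁, h₂, fun him => key ![-(b₂ / b₁).re, 1] (by simp) ?_⟩
    have hre : (((b₂ / b₁).re : ℝ) : ℂ) = b₂ / b₁ := Complex.ext (by simp) (by simp [him])
    simp only [Matrix.cons_val_zero, Matrix.cons_val_one, ofReal_neg, hre, ofReal_one]
    field_simp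
    ring
  · rintro ⟨h₁, -, him⟩ M hM
    have hn₁ : 0 < ‖b₁‖ := norm_pos_iff.mpr h₁
    have hS : 0 < ‖b₁‖ + ‖b₂‖ := by positivity
    set K := 1 + (‖b₂ / b₁‖ + 1) / |(b₂ / b₁).im| with hK
    have hKpos : 0 < K := by positivity
    refine ⟨K * ((M * (‖b₁‖ + ‖b₂‖) + ‖c‖) / ‖b₁‖), by positivity, fun ξ hξ => ?_⟩
    refine le_trans ?_ (norm_eval_le_mul_infDist hne hS _)
    have hw := le_of_mul_le_mul_left (hξ.trans (norm_le_mul_norm_add_mul _ him ξ)) hKpos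
    rw [div_le_iff₀ hn₁, ← norm_mul] at hw
    have e : ((ξ 0 : ℂ) + b₂ / b₁ * ξ 1) * b₁ = (b₁ * ξ 0 + b₂ * ξ 1 + c) - c := by
      field_simp
      ring
    rw [e] at hw
    rw [le_div_iff₀ hS]
    linarith [norm_sub_le (b₁ * (ξ 0 : ℂ) + b₂ * ξ 1 + c) c]
end

section
/- Let T, c ∈ ℂ with Im T ≠ 0. Then there is no entire function g : ℂ² → ℂ, not identically zero, such that g(z₁+1, z₂) = g(z₁,z₂) and g(z₁, z₂+1) = g(z₁,z₂) for all (z₁,z₂) ∈ ℂ², and whose zero set is exactly the set S = {(z₁,z₂) ∈ ℂ² : ∃ (p,q) ∈ ℤ², z₁ + T z₂ + c = p + qT}. (The periodic divisor Ŝ_L generated by a hyperplane L with l ∈ 𝓛₂ is not the divisor of any entire periodic function.) -/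
open Complex

open Set Filter Topology

theorem logDeriv_comp_add_const (f : ℂ → ℂ) (d z : ℂ) :
    logDeriv (fun w => f (w + d)) z = logDeriv f (z + d) := by
  rw [logDeriv_apply, logDeriv_apply, deriv_comp_add_const]

/-- If two entire functions are nonvanishing and close to each other (relative to their size) along
a real segment, and their ratio takes the same value at both ends, then their logarithmic
derivatives have the same integral along that segment. -/
theorem integral_logDeriv_eq_of_norm_div_sub_one_lt {φ ψ : ℂ → ℂ} {a b : ℝ}
    (hφ : Differentiable ℂ φ) (hψ : Differentiable ℂ ψ)
    (hφ0 : ∀ t ∈ uIcc a b, φ (t : ℝ) ≠ 0) (hψ0 : ∀ t ∈ uIcc a b, ψ (t : ℝ) ≠ 0)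
    (hends : φ b / ψ b = φ a / ψ a)
    (hclose : ∀ t ∈ uIcc a b, ‖φ (t : ℝ) / ψ (t : ℝ) - 1‖ < 1) :
    ∫ t in a..b, logDeriv φ (t : ℝ) = ∫ t in a..b, logDeriv ψ (t : ℝ) := by
  have hcont : ∀ χ : ℂ → ℂ, Differentiable ℂ χ → (∀ t ∈ uIcc a b, χ (t : ℝ) ≠ 0) →
      IntervalIntegrable (fun t : ℝ => logDeriv χ t) MeasureTheory.volume a b := by
    intro χ hχ h0
    refine ContinuousOn.intervalIntegrable ?_
    have h1 : Continuous (deriv χ) := (hχ.contDiff (n := 1)).continuous_deriv le_rfl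
    exact (h1.comp continuous_ofReal).continuousOn.div
      (hχ.continuous.comp continuous_ofReal).continuousOn h0
  have hderiv : ∀ t ∈ uIcc a b, HasDerivAt (fun t : ℝ => log (φ t / ψ t))
      (logDeriv φ (t : ℝ) - logDeriv ψ (t : ℝ)) t := by
    intro t ht
    have hslit : φ t / ψ t ∈ slitPlane := by
      have := (abs_re_le_norm (φ t / ψ t - 1)).trans_lt (hclose t ht)
      rw [sub_re, one_re, abs_lt] at this
      exact Or.inl (by linarith)
    have h := ((((hφ t).hasDerivAt).div ((hψ t).hasDerivAt) (hψ0 t ht)).clog hslit).comp_ofReal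
    have h1 := hφ0 t ht
    have h2 := hψ0 t ht
    refine h.congr_deriv ?_
    simp only [logDeriv_apply, Pi.div_apply]
    field_simp
  have h := intervalIntegral.integral_eq_sub_of_hasDerivAt hderiv
    ((hcont φ hφ hφ0).sub (hcont ψ hψ hψ0))
  rw [intervalIntegral.integral_sub (hcont φ hφ hφ0) (hcont ψ hψ hψ0), hends, sub_self] at h
  exact sub_eq_zero.mp h

/-- The integral of the logarithmic derivative along a closed-up real segment is invariant under
homotopies through entire functions that do not vanish on the segment. -/
theorem integral_logDeriv_eq_of_homotopy {H : ℝ → ℂ → ℂ} {a b : ℝ}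
    (hd : ∀ s, Differentiable ℂ (H s)) (hc : Continuous fun p : ℝ × ℝ => H p.1 p.2)
    (h0 : ∀ s, ∀ t : ℝ, H s t ≠ 0) (hends : ∀ s, H s b = H s a) (s₀ s₁ : ℝ) :
    ∫ t in a..b, logDeriv (H s₀) (t : ℝ) = ∫ t in a..b, logDeriv (H s₁) (t : ℝ) := by
  refine IsLocallyConstant.apply_eq_of_preconnectedSpace
    (f := fun s => ∫ t in a..b, logDeriv (H s) (t : ℝ)) ?_ s₀ s₁
  rw [IsLocallyConstant.iff_eventually_eq]
  intro s
  have key : ∀ᶠ s' in 𝓝 s, ∀ t ∈ uIcc a b, ‖H s' (t : ℝ) / H s (t : ℝ) - 1‖ < 1 := by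
    refine isCompact_uIcc.eventually_forall_of_forall_eventually fun t _ => ?_
    have hcont : Continuous fun p : ℝ × ℝ => ‖H p.1 (p.2 : ℝ) / H s (p.2 : ℝ) - 1‖ :=
      ((hc.div ((hd s).continuous.comp (continuous_ofReal.comp continuous_snd))
        fun p => h0 s p.2).sub continuous_const).norm
    refine hcont.continuousAt.eventually_lt continuousAt_const ?_
    simp [div_self (h0 s t)]
  filter_upwards [key] with s' hs'
  exact integral_logDeriv_eq_of_norm_div_sub_one_lt (hd s') (hd s) (fun t _ => h0 s' t)
    (fun t _ => h0 s t) (by rw [hends, hends]) hs'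

/-- An entire function which does not vanish identically near the origin is a power of the variable
times an entire function that is nonzero at the origin. -/
theorem exists_eq_pow_mul_of_differentiable {f : ℂ → ℂ} (hf : Differentiable ℂ f)
    (hne : ¬ ∀ᶠ z in 𝓝 0, f z = 0) :
    ∃ (m : ℕ) (u : ℂ → ℂ), Differentiable ℂ u ∧ u 0 ≠ 0 ∧ ∀ z, f z = z ^ m * u z := by
  obtain ⟨p, hp⟩ := hf.analyticAt 0
  refine ⟨p.order, (Function.swap dslope 0)^[p.order] f, ?_,
    hp.iterate_dslope_fslope_ne_zero (hne ∘ hp.locally_zero_iff.mpr),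
    fun z => by simpa using hp.eq_pow_order_mul_iterate_dslope z⟩
  generalize p.order = n
  induction n with
  | zero => exact hf
  | succ n ih =>
    rw [Function.iterate_succ_apply', ← differentiableOn_univ]
    exact (differentiableOn_dslope univ_mem).mpr ih.differentiableOn

/-- The integral of a function along the boundary of the rectangle `[-a, a] × [-b, b]`. -/
noncomputable def rectBoundaryIntegral (f : ℂ → ℂ) (a b : ℝ) : ℂ :=
  (∫ x : ℝ in (-a)..a, f (x + (-b : ℝ) * I)) - (∫ x : ℝ in (-a)..a, f (x + b * I)) +
    I * (∫ y : ℝ in (-b)..b, f (a + y * I)) - I * ∫ y : ℝ in (-b)..b, f ((-a : ℝ) + y * I)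

theorem rectBoundaryIntegral_eq_zero {f : ℂ → ℂ} {a b : ℝ}
    (hf : ∀ z : ℂ, z.re ∈ uIcc (-a) a → z.im ∈ uIcc (-b) b → DifferentiableAt ℂ f z) :
    rectBoundaryIntegral f a b = 0 := by
  have h := integral_boundary_rect_eq_zero_of_differentiableOn f ⟨-a, -b⟩ ⟨a, b⟩
    fun z hz => (hf z hz.1 hz.2).differentiableWithinAt
  simpa only [rectBoundaryIntegral, smul_eq_mul] using h

theorem rectBoundaryIntegral_congr_mul_add {f g h : ℂ → ℂ} {a b : ℝ} (k : ℂ)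
    (ha : 0 < a) (hb : 0 < b)
    (hg : ∀ z : ℂ, |z.re| ≤ a → |z.im| ≤ b → z ≠ 0 → ContinuousAt g z)
    (hh : ∀ z : ℂ, |z.re| ≤ a → |z.im| ≤ b → z ≠ 0 → ContinuousAt h z)
    (hfgh : ∀ z : ℂ, |z.re| ≤ a → |z.im| ≤ b → z ≠ 0 → f z = k * g z + h z) :
    rectBoundaryIntegral f a b = k * rectBoundaryIntegral g a b + rectBoundaryIntegral h a b := by
  have side : ∀ (γ : ℝ → ℂ) (c : ℝ), 0 < c → Continuous γ →
      (∀ t, |t| ≤ c → |(γ t).re| ≤ a ∧ |(γ t).im| ≤ b ∧ γ t ≠ 0) →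
      ∫ t in (-c)..c, f (γ t) = k * (∫ t in (-c)..c, g (γ t)) + ∫ t in (-c)..c, h (γ t) := by
    intro γ c hc hγ hmem
    have hmem' : ∀ t ∈ uIcc (-c) c, |(γ t).re| ≤ a ∧ |(γ t).im| ≤ b ∧ γ t ≠ 0 := fun t ht => by
      rw [uIcc_of_le (by linarith)] at ht
      exact hmem t (abs_le.mpr ht)
    have intble : ∀ F : ℂ → ℂ, (∀ z : ℂ, |z.re| ≤ a → |z.im| ≤ b → z ≠ 0 → ContinuousAt F z) →
        IntervalIntegrable (fun t => F (γ t)) MeasureTheory.volume (-c) c := fun F hF =>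
      ContinuousOn.intervalIntegrable fun t ht =>
        (ContinuousAt.comp (hF _ (hmem' t ht).1 (hmem' t ht).2.1 (hmem' t ht).2.2)
          hγ.continuousAt).continuousWithinAt
    rw [← intervalIntegral.integral_const_mul,
      ← intervalIntegral.integral_add ((intble g hg).const_mul k) (intble h hh)]
    exact intervalIntegral.integral_congr fun t ht =>
      hfgh _ (hmem' t ht).1 (hmem' t ht).2.1 (hmem' t ht).2.2
  have hor : ∀ β : ℝ, |β| = b → ∀ t : ℝ, |t| ≤ a →
      |((t : ℂ) + β * I).re| ≤ a ∧ |((t : ℂ) + β * I).im| ≤ b ∧ (t : ℂ) + β * I ≠ 0 := by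
    intro β hβ t ht
    refine ⟨by simpa using ht, by simp [hβ], fun h0 => ?_⟩
    have : β = 0 := by simpa using congrArg im h0
    simp [this] at hβ
    exact hb.ne hβ
  have ver : ∀ α : ℝ, |α| = a → ∀ t : ℝ, |t| ≤ b →
      |((α : ℂ) + t * I).re| ≤ a ∧ |((α : ℂ) + t * I).im| ≤ b ∧ (α : ℂ) + t * I ≠ 0 := by
    intro α hα t ht
    refine ⟨by simp [hα], by simpa using ht, fun h0 => ?_⟩
    have : α = 0 := by simpa using congrArg re h0
    simp [this] at hα
    exact ha.ne hα
  have ha' : |a| = a := abs_of_pos ha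
  have hb' : |b| = b := abs_of_pos hb
  unfold rectBoundaryIntegral
  rw [side (fun t => t + (-b : ℝ) * I) a ha (by fun_prop) (hor _ (by rw [abs_neg, hb'])),
    side (fun t => t + b * I) a ha (by fun_prop) (hor _ hb'),
    side (fun t => a + t * I) b hb (by fun_prop) (ver _ ha'),
    side (fun t => (-a : ℝ) + t * I) b hb (by fun_prop) (ver _ (by rw [abs_neg, ha']))]
  ring

theorem rectBoundaryIntegral_inv_ne_zero {a b : ℝ} (ha : 0 < a) (hb : 0 < b) :
    rectBoundaryIntegral (fun z => z⁻¹) a b ≠ 0 := by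
  have hor : ∀ β : ℝ, β ≠ 0 → (∫ x : ℝ in (-a)..a, ((x : ℂ) + β * I)⁻¹).im =
      ∫ x : ℝ in (-a)..a, -β / (x ^ 2 + β ^ 2) := by
    intro β hβ
    have hc : Continuous fun x : ℝ => ((x : ℂ) + β * I)⁻¹ :=
      Continuous.inv₀ (by fun_prop) fun x h => hβ (by simpa using congrArg im h)
    rw [← imCLM_apply, ← imCLM.intervalIntegral_comp_comm (hc.intervalIntegrable _ _)]
    refine intervalIntegral.integral_congr fun x _ => ?_
    simp [inv_im, normSq_apply, sq]
  have ver : ∀ α : ℝ, α ≠ 0 → (∫ y : ℝ in (-b)..b, ((α : ℂ) + y * I)⁻¹).re =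
      ∫ y : ℝ in (-b)..b, α / (α ^ 2 + y ^ 2) := by
    intro α hα
    have hc : Continuous fun y : ℝ => ((α : ℂ) + y * I)⁻¹ :=
      Continuous.inv₀ (by fun_prop) fun x h => hα (by simpa using congrArg re h)
    rw [← reCLM_apply, ← reCLM.intervalIntegral_comp_comm (hc.intervalIntegrable _ _)]
    refine intervalIntegral.integral_congr fun x _ => ?_
    simp [inv_re, normSq_apply, sq]
  have hpos₁ : 0 < ∫ x : ℝ in (-a)..a, b / (x ^ 2 + b ^ 2) := by
    refine intervalIntegral.intervalIntegral_pos_of_pos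
      (Continuous.intervalIntegrable ?_ _ _) (fun x => by positivity) (by linarith)
    exact continuous_const.div (by fun_prop) fun x => by positivity
  have hpos₂ : 0 < ∫ y : ℝ in (-b)..b, a / (a ^ 2 + y ^ 2) := by
    refine intervalIntegral.intervalIntegral_pos_of_pos
      (Continuous.intervalIntegrable ?_ _ _) (fun x => by positivity) (by linarith)
    exact continuous_const.div (by fun_prop) fun x => by positivity
  intro h
  have him := congrArg im h
  simp only [rectBoundaryIntegral, sub_im, add_im, I_mul_im, zero_im, hor _ hb.ne',
    hor _ (neg_ne_zero.mpr hb.ne'), ver _ ha.ne', ver _ (neg_ne_zero.mpr ha.ne'), neg_neg, neg_sq,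
    neg_div, intervalIntegral.integral_neg] at him
  linarith

/-- A `1`-periodic entire function whose only zero in the rectangle `[-1/2, 1/2] × [-b, b]` is the
origin has different winding numbers along the lower and the upper side. -/
theorem integral_logDeriv_ne_of_periodic {f : ℂ → ℂ} (hf : Differentiable ℂ f)
    (hper : ∀ z, f (z + 1) = f z) {b : ℝ} (hb : 0 < b)
    (hzero : ∀ z : ℂ, |z.re| ≤ 1 / 2 → |z.im| ≤ b → (f z = 0 ↔ z = 0)) :
    ∫ x : ℝ in (-(1 / 2))..(1 / 2), logDeriv f (x + (-b : ℝ) * I) ≠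
      ∫ x : ℝ in (-(1 / 2))..(1 / 2), logDeriv f (x + b * I) := by
  intro heq
  have hne : ¬ ∀ᶠ z in 𝓝 0, f z = 0 := by
    intro h
    have hre : ∀ᶠ z : ℂ in 𝓝 0, |z.re| < 1 / 2 :=
      (continuous_re.abs.continuousAt).eventually_lt continuousAt_const (by simp)
    have him : ∀ᶠ z : ℂ in 𝓝 0, |z.im| < b :=
      (continuous_im.abs.continuousAt).eventually_lt continuousAt_const (by simpa using hb)
    have hall := ((h.and (hre.and him)).filter_mono nhdsWithin_le_nhds).and
      (self_mem_nhdsWithin : {(0 : ℂ)}ᶜ ∈ 𝓝[≠] 0)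
    obtain ⟨z, ⟨hz, hz₁, hz₂⟩, hz0⟩ := hall.exists
    exact hz0 ((hzero z hz₁.le hz₂.le).mp hz)
  obtain ⟨m, u, hu, hu0, hfu⟩ := exists_eq_pow_mul_of_differentiable hf hne
  have hm : m ≠ 0 := by
    rintro rfl
    have := (hzero 0 (by simp) (by simpa using hb.le)).mpr rfl
    rw [hfu] at this
    simp [hu0] at this
  have hune : ∀ z : ℂ, |z.re| ≤ 1 / 2 → |z.im| ≤ b → u z ≠ 0 := by
    intro z h₁ h₂ hz
    have : z = 0 := (hzero z h₁ h₂).mp (by rw [hfu, hz, mul_zero])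
    exact hu0 (this ▸ hz)
  have hu' : ∀ z : ℂ, |z.re| ≤ 1 / 2 → |z.im| ≤ b → DifferentiableAt ℂ (logDeriv u) z :=
    fun z h₁ h₂ => (hu.contDiff.differentiable_deriv_two z).div (hu z) (hune z h₁ h₂)
  have hsplit : rectBoundaryIntegral (logDeriv f) (1 / 2) b =
      m * rectBoundaryIntegral (fun z => z⁻¹) (1 / 2) b +
        rectBoundaryIntegral (logDeriv u) (1 / 2) b := by
    refine rectBoundaryIntegral_congr_mul_add m (by norm_num) hb
      (fun z _ _ hz => continuousAt_inv₀ hz) (fun z h₁ h₂ _ => (hu' z h₁ h₂).continuousAt)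
      fun z h₁ h₂ hz => ?_
    rw [show f = fun z => z ^ m * u z from funext hfu,
      logDeriv_mul (f := fun z => z ^ m) z (pow_ne_zero m hz) (hune z h₁ h₂) (by fun_prop) (hu z)]
    congr 1
    simp [div_eq_mul_inv]
  have hu_int : rectBoundaryIntegral (logDeriv u) (1 / 2) b = 0 :=
    rectBoundaryIntegral_eq_zero fun z h₁ h₂ => by
      rw [uIcc_of_le (by linarith)] at h₁ h₂
      exact hu' z (abs_le.mpr h₁) (abs_le.mpr h₂)
  have hper' : ∀ z, logDeriv f (z + 1) = logDeriv f z := fun z => by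
    rw [← logDeriv_comp_add_const, funext hper]
  have hf_int : rectBoundaryIntegral (logDeriv f) (1 / 2) b = 0 := by
    have hsides : ∀ y : ℝ, logDeriv f (((1 / 2 : ℝ) : ℂ) + y * I) =
        logDeriv f (((-(1 / 2) : ℝ) : ℂ) + y * I) := fun y => by
      rw [← hper' (((-(1 / 2) : ℝ) : ℂ) + y * I)]
      congr 1
      push_cast
      ring
    simp only [rectBoundaryIntegral, heq, hsides]
    ring
  rw [hf_int, hu_int, add_zero, eq_comm, mul_eq_zero] at hsplit
  exact hsplit.elim (by exact_mod_cast hm)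
    (rectBoundaryIntegral_inv_ne_zero (by norm_num) hb)

/-- For `Im T ≠ 0`, the periodic reproduction of the line `{z₁ + Tz₂ + c = 0}` is
not the zero set of any entire function on `ℂ²` periodic with periods `(1,0)` and
`(0,1)`. -/
theorem no_periodic_function_L2_dim2 (T c : ℂ) (hT : T.im ≠ 0) :
    ¬ ∃ g : (Fin 2 → ℂ) → ℂ, Differentiable ℂ g ∧ g ≠ 0 ∧
      (∀ z, g (z + Pi.single 0 1) = g z) ∧
      (∀ z, g (z + Pi.single 1 1) = g z) ∧
      (∀ z, g z = 0 ↔ ∃ p q : ℤ, z 0 + T * z 1 + c = (p : ℂ) + (q : ℂ) * T) := by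
  rintro ⟨g, hg, -, hper₀, hper₁, hzero⟩
  have hz : ∀ x y : ℂ, g ![x, y] = 0 ↔ ∃ p q : ℤ, x + T * y + c = (p : ℂ) + (q : ℂ) * T :=
    fun x y => by simpa using hzero ![x, y]
  have hp₀ : ∀ x y : ℂ, g ![x + 1, y] = g ![x, y] := fun x y => by
    rw [← hper₀ ![x, y]]
    congr 1
    ext i
    fin_cases i <;> simp
  have hp₁ : ∀ x y : ℂ, g ![x, y + 1] = g ![x, y] := fun x y => by
    rw [← hper₁ ![x, y]]
    congr 1
    ext i
    fin_cases i <;> simp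
  have hslice : ∀ y d : ℂ, Differentiable ℂ fun w : ℂ => g ![w + d, y] := fun y d =>
    hg.comp (differentiable_pi.mpr fun i => by
      fin_cases i
      exacts [differentiable_id.add_const d, differentiable_const y])
  have him : ∀ w : ℂ, (∃ p q : ℤ, w = (p : ℂ) + (q : ℂ) * T) → ∃ q : ℤ, w.im = q * T.im := by
    rintro w ⟨p, q, rfl⟩
    exact ⟨q, by simp⟩
  -- Moving along the second period from the height `T.im / 2` to the height `-T.im / 2`.
  have hhom : ∫ x : ℝ in (-(1 / 2))..(1 / 2), logDeriv (fun w => g ![w - c, 0])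
        (x + (T.im / 2 : ℝ) * I) =
      ∫ x : ℝ in (-(1 / 2))..(1 / 2), logDeriv (fun w => g ![w - c, 0])
        (x + (-(T.im / 2) : ℝ) * I) := by
    have h := integral_logDeriv_eq_of_homotopy (a := -(1 / 2)) (b := 1 / 2)
      (H := fun s w => g ![w + ((T.im / 2 : ℝ) * I - s * (T.im * I) - c), s])
      (fun s => hslice _ _)
      (hg.continuous.comp (continuous_pi fun i => by fin_cases i <;> simp <;> fun_prop))
      (fun s t h => ?_) (fun s => ?_) 0 1
    · have hstart : (fun w : ℂ => g ![w + ((T.im / 2 : ℝ) * I - (0 : ℝ) * (T.im * I) - c),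
          (0 : ℝ)]) = fun w => g ![w + (T.im / 2 : ℝ) * I - c, 0] := by
        ext w
        congr 2
        push_cast
        ring
      have hend : (fun w : ℂ => g ![w + ((T.im / 2 : ℝ) * I - (1 : ℝ) * (T.im * I) - c),
          (1 : ℝ)]) = fun w => g ![w + (-(T.im / 2) : ℝ) * I - c, 0] := by
        ext w
        rw [← hp₁ _ 0]
        congr 2
        · push_cast; ring
        · simp
      rw [hstart, hend] at h
      simpa only [logDeriv_comp_add_const (fun w => g ![w - c, 0])] using h
    · have hw := (hz _ _).mp h
      obtain ⟨q, hq⟩ := him _ hw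
      simp at hq
      have hq' : (2 * q : ℝ) = 1 := mul_right_cancel₀ hT (by linarith)
      have : 2 * q = 1 := by exact_mod_cast hq'
      omega
    · refine (congrArg (fun x => g ![x, s]) ?_).trans (hp₀ _ _)
      push_cast
      ring
  have hzero' : ∀ z : ℂ, |z.re| ≤ 1 / 2 → |z.im| ≤ |T.im / 2| → (g ![z - c, 0] = 0 ↔ z = 0) := by
    intro z h₁ h₂
    rw [hz]
    constructor
    · rintro ⟨p, q, hpq⟩
      have hz' : z = p + q * T := by simpa using hpq
      have hT' := abs_pos.mpr hT
      have hq : q = 0 := by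
        rw [hz'] at h₂
        simp [abs_mul, abs_div] at h₂
        have : |(q : ℝ)| < 1 := by nlinarith
        exact Int.abs_lt_one_iff.mp (by exact_mod_cast this)
      have hp : p = 0 := by
        rw [hz', hq] at h₁
        simp at h₁
        have : |(p : ℝ)| < 1 := by linarith
        exact Int.abs_lt_one_iff.mp (by exact_mod_cast this)
      simp [hz', hp, hq]
    · rintro rfl
      exact ⟨0, 0, by simp⟩
  have hne := integral_logDeriv_ne_of_periodic (hslice 0 (-c))
    (fun z => (congrArg (fun x => g ![x, 0]) (by ring)).trans (hp₀ _ _))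
    (abs_pos.mpr (div_ne_zero hT two_ne_zero))
    (by simpa only [← sub_eq_add_neg] using hzero')
  simp only [← sub_eq_add_neg] at hne
  rcases abs_choice (T.im / 2) with h | h <;> rw [h] at hne
  · exact hne hhom.symm
  · rw [neg_neg] at hne
    exact hne hhom
end

section
/- Let n ≥ 1, let r, s ∈ ℚⁿ be linearly independent over ℚ, let b₁, b₂ ∈ ℂ with b₁ ≠ 0, b₂ ≠ 0 and Im(b₂/b₁) ≠ 0, and define a ∈ ℂⁿ by a_j = b₁ r_j + b₂ s_j. Then the additive subgroup 𝒜 = {⟨a,k⟩ : k ∈ ℤⁿ} of ℂ is a free group with two generators spanning a lattice: there exist w₁, w₂ ∈ ℂ, both nonzero, with w₂/w₁ ∉ ℝ, such that 𝒜 = {j₁ w₁ + j₂ w₂ : (j₁, j₂) ∈ ℤ²}. -/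
open Complex

/-- The columns of a rational two-row matrix with independent rows generate a lattice in `ℚ²`,
spanned over `ℤ` by two vectors with nonzero determinant. -/
theorem exists_span_int_col_eq_span_pair {ι : Type*} [Fintype ι] {M : Matrix (Fin 2) ι ℚ}
    (hM : LinearIndependent ℚ M.row) :
    ∃ u v : Fin 2 → ℚ, u 0 * v 1 - u 1 * v 0 ≠ 0 ∧
      Submodule.span ℤ (Set.range M.col) = Submodule.span ℤ {u, v} := by
  have hspan : Submodule.span ℚ (Set.range M.col) = ⊤ := by
    apply Submodule.eq_top_of_finrank_eq
    rw [← M.rank_eq_finrank_span_cols, hM.rank_matrix, Module.finrank_fin_fun, Fintype.card_fin]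
  have hlat : (Submodule.span ℤ (Set.range M.col)).IsLattice ℚ :=
    ⟨Submodule.fg_span (Set.finite_range _), by rw [Submodule.span_span_of_tower, hspan]⟩
  let b := Module.finBasisOfFinrankEq ℤ (Submodule.span ℤ (Set.range M.col))
    ((Submodule.IsLattice.finrank_of_pi (K := ℚ) _).trans (Fintype.card_fin 2))
  refine ⟨b 0, b 1, ?_, ?_⟩
  · have hli := (b.extendOfIsLattice ℚ).linearIndependent
    have hdet := (Matrix.isUnit_iff_isUnit_det _).mp
      (Matrix.linearIndependent_rows_iff_isUnit.mp
        (show LinearIndependent ℚ (Matrix.of (b.extendOfIsLattice ℚ)).row from hli))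
    have hne := hdet.ne_zero
    rw [Matrix.det_fin_two] at hne
    simpa using hne
  · have h := congrArg (Submodule.map (Submodule.span ℤ (Set.range M.col)).subtype) b.span_eq
    rw [Submodule.map_span, Submodule.map_top, Submodule.range_subtype, ← Set.range_comp] at h
    refine h.symm.trans (congrArg _ ?_)
    ext x
    simp [Fin.exists_fin_two, eq_comm]

/-- The additive map `ℚ² → ℂ` given by `u ↦ b₁ u₀ + b₂ u₁`. -/
noncomputable def ratPairCombination (b₁ b₂ : ℂ) : (Fin 2 → ℚ) →ₗ[ℤ] ℂ :=
  AddMonoidHom.toIntLinearMap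
    { toFun := fun u => b₁ * (u 0 : ℂ) + b₂ * (u 1 : ℂ)
      map_zero' := by simp
      map_add' := fun u v => by simp; ring }

theorem ratPairCombination_apply (b₁ b₂ : ℂ) (u : Fin 2 → ℚ) :
    ratPairCombination b₁ b₂ u = b₁ * (u 0 : ℂ) + b₂ * (u 1 : ℂ) := rfl

theorem eq_zero_of_ofReal_combination_eq_zero {b₁ b₂ : ℂ} (hb₁ : b₁ ≠ 0)
    (hIm : (b₂ / b₁).im ≠ 0) {x y : ℝ} (h : b₁ * (x : ℂ) + b₂ * (y : ℂ) = 0) :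
    x = 0 ∧ y = 0 := by
  have h' : (x : ℂ) + b₂ / b₁ * (y : ℂ) = 0 := by
    field_simp
    linear_combination h
  have hy : y = 0 := by simpa [hIm] using congrArg Complex.im h'
  subst hy
  exact ⟨by simpa using h', rfl⟩

theorem im_ratPairCombination_div_ne_zero {b₁ b₂ : ℂ} (hb₁ : b₁ ≠ 0)
    (hIm : (b₂ / b₁).im ≠ 0) {u v : Fin 2 → ℚ} (hdet : u 0 * v 1 - u 1 * v 0 ≠ 0) :
    (ratPairCombination b₁ b₂ v / ratPairCombination b₁ b₂ u).im ≠ 0 := by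
  have hu : ratPairCombination b₁ b₂ u ≠ 0 := fun h => by
    rw [ratPairCombination_apply] at h
    obtain ⟨h0, h1⟩ := eq_zero_of_ofReal_combination_eq_zero hb₁ hIm
      (x := (u 0 : ℝ)) (y := (u 1 : ℝ)) (by exact_mod_cast h)
    norm_cast at h0 h1
    simp [h0, h1] at hdet
  intro him
  set c : ℝ := (ratPairCombination b₁ b₂ v / ratPairCombination b₁ b₂ u).re with hc
  have hcv : ratPairCombination b₁ b₂ v = (c : ℂ) * ratPairCombination b₁ b₂ u := by
    rw [← div_eq_iff hu]
    exact Complex.ext (by simp [hc]) (by simpa using him)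
  rw [ratPairCombination_apply, ratPairCombination_apply] at hcv
  obtain ⟨h0, h1⟩ := eq_zero_of_ofReal_combination_eq_zero hb₁ hIm
    (x := (v 0 : ℝ) - c * (u 0 : ℝ)) (y := (v 1 : ℝ) - c * (u 1 : ℝ)) (by
      push_cast
      linear_combination hcv)
  apply hdet
  have : (u 0 : ℝ) * v 1 - u 1 * v 0 = 0 := by linear_combination (u 0 : ℝ) * h1 - (u 1 : ℝ) * h0
  exact_mod_cast this


open Complex

/-- For `a = b₁ r + b₂ s` with `r, s` rational vectors linearly independent over `ℚ`
and `b₁, b₂` nonzero with `Im (b₂/b₁) ≠ 0`, the group `𝒜 = {⟨a,k⟩ : k ∈ ℤⁿ}` is a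
free group with two generators spanning a lattice. -/
theorem group_is_lattice (n : ℕ) (hn : 1 ≤ n)
    (r s : Fin n → ℚ) (hrs : LinearIndependent ℚ ![r, s])
    (b₁ b₂ : ℂ) (hb₁ : b₁ ≠ 0) (hb₂ : b₂ ≠ 0) (hIm : (b₂ / b₁).im ≠ 0)
    (a : Fin n → ℂ) (ha : ∀ j, a j = b₁ * (r j : ℂ) + b₂ * (s j : ℂ)) :
    ∃ w₁ w₂ : ℂ, w₁ ≠ 0 ∧ w₂ ≠ 0 ∧ (w₂ / w₁).im ≠ 0 ∧
      {x : ℂ | ∃ k : Fin n → ℤ, x = ∑ j, a j * (k j : ℂ)}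
        = {x : ℂ | ∃ j₁ j₂ : ℤ, x = (j₁ : ℂ) * w₁ + (j₂ : ℂ) * w₂} := by
  obtain ⟨u, v, hdet, hspan⟩ := exists_span_int_col_eq_span_pair (M := Matrix.of ![r, s]) hrs
  have hw := im_ratPairCombination_div_ne_zero hb₁ hIm hdet
  refine ⟨ratPairCombination b₁ b₂ u, ratPairCombination b₁ b₂ v, fun h => by simp [h] at hw,
    fun h => by simp [h] at hw, hw, ?_⟩
  have hcol : ⇑(ratPairCombination b₁ b₂) ∘ (Matrix.of ![r, s]).col = a := by
    ext j
    simp [ratPairCombination_apply, Matrix.col_apply, ha]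
  have h := congrArg (Submodule.map (ratPairCombination b₁ b₂)) hspan
  rw [Submodule.map_span, Submodule.map_span, ← Set.range_comp, hcol, Set.image_pair] at h
  ext x
  have hx := SetLike.ext_iff.mp h x
  rw [Submodule.mem_span_range_iff_exists_fun, Submodule.mem_span_pair] at hx
  simpa [eq_comm, mul_comm] using hx
end

section
/- Let n ≥ 1, let k : ℕ → ℤⁿ be a sequence of nonzero integer vectors and c : ℕ → ℂ a sequence of complex numbers such that |Im c_j| / ‖k_j‖ tends to +∞ as j → ∞. Then for every R > 0, the set of indices j for which the set ⋃_{m∈ℤ} {z ∈ ℂⁿ : ⟨k_j,z⟩+c_j = m} meets the closed ball of radius R centered at 0 is finite. (The sum of divisors Σ_j Ŝ_{L_j} with l_j ∈ 𝓛₁ is locally finite, hence a divisor, when |Im c_j|/‖k_j‖ → ∞.) -/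
open Complex

/-- If `⟨k,z⟩ + c` is an integer for some `z` of sup norm at most `R`, then `|Im c|` is at most
`n * R` times the Euclidean norm of `k`. -/
theorem abs_im_le_of_sum_intCast_mul_add_eq_intCast {n : ℕ} {k : Fin n → ℤ} {c : ℂ} {R : ℝ}
    {z : Fin n → ℂ} (hz : ‖z‖ ≤ R) {m : ℤ} (h : (∑ i, (k i : ℂ) * z i) + c = (m : ℂ)) :
    |c.im| ≤ n * R * Real.sqrt (∑ i, ((k i : ℝ)) ^ 2) := by
  have him : (∑ i, (k i : ℝ) * (z i).im) + c.im = 0 := by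
    simpa [Complex.im_sum] using congrArg Complex.im h
  have hterm (i : Fin n) :
      |(k i : ℝ) * (z i).im| ≤ Real.sqrt (∑ i, ((k i : ℝ)) ^ 2) * R := by
    rw [abs_mul]
    gcongr
    · exact Real.abs_le_sqrt
        (Finset.single_le_sum (f := fun i => (k i : ℝ) ^ 2) (fun _ _ => sq_nonneg _)
          (Finset.mem_univ i))
    · exact (Complex.abs_im_le_norm _).trans ((norm_le_pi_norm z i).trans hz)
  calc |c.im| = |∑ i, (k i : ℝ) * (z i).im| := by
        rw [eq_neg_of_add_eq_zero_right him, abs_neg]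
    _ ≤ ∑ i, |(k i : ℝ) * (z i).im| := Finset.abs_sum_le_sum_abs _ _
    _ ≤ ∑ _i : Fin n, Real.sqrt (∑ i, ((k i : ℝ)) ^ 2) * R :=
        Finset.sum_le_sum fun i _ => hterm i
    _ = n * R * Real.sqrt (∑ i, ((k i : ℝ)) ^ 2) := by
        simp only [Finset.sum_const, Finset.card_univ, Fintype.card_fin, nsmul_eq_mul]
        ring

/-- If `|Im c_j|/‖k_j‖ → ∞`, the family of periodic reproductions of the hyperplanes
`{⟨k_j,z⟩+c_j = 0}` is locally finite: only finitely many of the sets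
`⋃_{m∈ℤ} {⟨k_j,z⟩+c_j = m}` meet any fixed closed ball. -/
theorem sum_of_L1_divisors_locally_finite (n : ℕ) (hn : 1 ≤ n)
    (k : ℕ → Fin n → ℤ) (hk : ∀ j, k j ≠ 0) (c : ℕ → ℂ)
    (hγ : Filter.Tendsto
      (fun j => |(c j).im| / Real.sqrt (∑ m, ((k j m : ℝ)) ^ 2))
      Filter.atTop Filter.atTop)
    (R : ℝ) (hR : 0 < R) :
    {j : ℕ | ∃ z : Fin n → ℂ, z ∈ Metric.closedBall (0 : Fin n → ℂ) R ∧
      ∃ m : ℤ, (∑ i, (k j i : ℂ) * z i) + c j = (m : ℂ)}.Finite := by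
  have hev := hγ.eventually_gt_atTop (n * R)
  rw [← Nat.cofinite_eq_atTop, Filter.eventually_cofinite] at hev
  refine hev.subset ?_
  rintro j ⟨z, hz, m, h⟩
  rw [mem_closedBall_zero_iff] at hz
  rw [Set.mem_ofPred_eq, not_lt]
  exact div_le_of_le_mul₀ (Real.sqrt_nonneg _) (by positivity)
    (abs_im_le_of_sum_intCast_mul_add_eq_intCast hz h)
end
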